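/- arXiv:1401.7337 — 2 statements merged into one kernel-verified Lean document; each statement's English description precedes it below -/
import Mathlib

section
/- For every n ≥ 1, every function f : {−1,1}^n → ℝ, and every t ≥ 0, Var_ν(T_t f) ≤ 7 · (Σ_{i=1}^n ‖D_i f‖_{L¹(ν)}²)^{(1−e^{−t})/2} · ‖f‖_{L²(ν)}^{1+e^{−t}}. -/
open Finset

/-- Expectation with respect to the uniform measure `ν` on the discrete cube `{-1,1}ⁿ`,
coordinates encoded by `Bool` (`true ↔ 1`, `false ↔ -1`). -/
noncomputable def cubeE (n : ℕ) (f : (Fin n → Bool) → ℝ) : ℝ :=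
  (∑ x : Fin n → Bool, f x) / 2 ^ n

/-- Variance with respect to the uniform measure on the discrete cube. -/
noncomputable def cubeVar (n : ℕ) (f : (Fin n → Bool) → ℝ) : ℝ :=
  cubeE n (fun x => f x ^ 2) - (cubeE n f) ^ 2

/-- `τ_i x` : flip the `i`-th coordinate. -/
def cubeFlip (n : ℕ) (i : Fin n) (x : Fin n → Bool) : Fin n → Bool :=
  Function.update x i (!(x i))

/-- Discrete derivative `D_i f (x) = f (τ_i x) - f x`. -/
noncomputable def Dop (n : ℕ) (i : Fin n) (f : (Fin n → Bool) → ℝ) (x : Fin n → Bool) : ℝ :=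
  f (cubeFlip n i x) - f x

/-- The sign `±1` associated to a Boolean coordinate. -/
def sg (b : Bool) : ℝ := if b then 1 else -1

/-- The Bonami--Beckner semigroup
`T_t f (x) = ∫ f(ω) ∏ᵢ (1 + e^{-t} xᵢ ωᵢ) dν(ω)`. -/
noncomputable def Tt (n : ℕ) (t : ℝ) (f : (Fin n → Bool) → ℝ) (x : Fin n → Bool) : ℝ :=
  cubeE n (fun ω => f ω * ∏ i, (1 + Real.exp (-t) * sg (x i) * sg (ω i)))

section CubeFourier

theorem sg_mul_self (b : Bool) : sg b * sg b = 1 := by cases b <;> simp [sg]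

theorem abs_sg (b : Bool) : |sg b| = 1 := by cases b <;> simp [sg]

theorem cubeE_mono {n : ℕ} {f g : (Fin n → Bool) → ℝ} (h : ∀ x, f x ≤ g x) :
    cubeE n f ≤ cubeE n g := by
  unfold cubeE
  gcongr
  exact h _

theorem cubeE_nonneg {n : ℕ} {f : (Fin n → Bool) → ℝ} (h : ∀ x, 0 ≤ f x) : 0 ≤ cubeE n f :=
  div_nonneg (sum_nonneg fun x _ => h x) (by positivity)

theorem cubeE_add {n : ℕ} (f g : (Fin n → Bool) → ℝ) :
    cubeE n (fun x => f x + g x) = cubeE n f + cubeE n g := by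
  simp [cubeE, sum_add_distrib, add_div]

theorem cubeE_mul_left {n : ℕ} (c : ℝ) (f : (Fin n → Bool) → ℝ) :
    cubeE n (fun x => c * f x) = c * cubeE n f := by
  simp [cubeE, ← mul_sum, mul_div_assoc]

theorem cubeE_mul_right {n : ℕ} (c : ℝ) (f : (Fin n → Bool) → ℝ) :
    cubeE n (fun x => f x * c) = cubeE n f * c := by
  simp [cubeE, ← sum_mul, div_mul_eq_mul_div]

theorem cubeE_sum {n : ℕ} {ι : Type*} (s : Finset ι) (f : ι → (Fin n → Bool) → ℝ) :
    cubeE n (fun x => ∑ i ∈ s, f i x) = ∑ i ∈ s, cubeE n (f i) := by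
  simp only [cubeE]
  rw [sum_comm, sum_div]

theorem cubeE_comm {n : ℕ} (F : (Fin n → Bool) → (Fin n → Bool) → ℝ) :
    cubeE n (fun x => cubeE n (fun y => F x y)) = cubeE n (fun y => cubeE n (fun x => F x y)) := by
  simp only [cubeE, ← sum_div]
  rw [sum_comm]

theorem cubeE_mul_sq_le {n : ℕ} (f g : (Fin n → Bool) → ℝ) :
    cubeE n (fun x => f x * g x) ^ 2 ≤ cubeE n (fun x => f x ^ 2) * cubeE n (fun x => g x ^ 2) := by
  unfold cubeE
  rw [div_pow, div_mul_div_comm, ← sq]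
  gcongr
  exact sum_mul_sq_le_sq_mul_sq _ _ _

theorem cubeE_prod {n : ℕ} (u : Fin n → Bool → ℝ) :
    cubeE n (fun x => ∏ i, u i (x i)) = ∏ i, (u i true + u i false) / 2 := by
  have h := Finset.prod_univ_sum (fun _ : Fin n => (univ : Finset Bool)) u
  rw [Fintype.piFinset_univ] at h
  rw [cubeE, ← h, prod_div_distrib]
  simp

theorem cubeFlip_cubeFlip {n : ℕ} (i : Fin n) (x : Fin n → Bool) :
    cubeFlip n i (cubeFlip n i x) = x := by
  simp [cubeFlip]

theorem cubeE_comp_cubeFlip {n : ℕ} (i : Fin n) (f : (Fin n → Bool) → ℝ) :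
    cubeE n (fun x => f (cubeFlip n i x)) = cubeE n f := by
  unfold cubeE
  congr 1
  exact Equiv.sum_comp (Function.Involutive.toPerm _ (cubeFlip_cubeFlip i)) f

/-- The Walsh character indexed by `S`. -/
noncomputable def walsh {n : ℕ} (S : Finset (Fin n)) (x : Fin n → Bool) : ℝ := ∏ i ∈ S, sg (x i)

/-- The Walsh coefficient of `f` at `S`. -/
noncomputable def walshCoeff {n : ℕ} (f : (Fin n → Bool) → ℝ) (S : Finset (Fin n)) : ℝ :=
  cubeE n fun x => f x * walsh S x

/-- The noise operator with correlation `r`, so that `T_t` has correlation `e^{-t}`. -/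
noncomputable def noise (n : ℕ) (r : ℝ) (f : (Fin n → Bool) → ℝ) (x : Fin n → Bool) : ℝ :=
  cubeE n (fun ω => f ω * ∏ i, (1 + r * sg (x i) * sg (ω i)))

theorem walsh_eq_prod_ite {n : ℕ} (S : Finset (Fin n)) (x : Fin n → Bool) :
    walsh S x = ∏ i, if i ∈ S then sg (x i) else 1 := by
  simp [walsh, prod_ite_mem]

theorem noise_eq_sum {n : ℕ} (r : ℝ) (f : (Fin n → Bool) → ℝ) (x : Fin n → Bool) :
    noise n r f x = ∑ S : Finset (Fin n), r ^ #S * walshCoeff f S * walsh S x := by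
  have h : ∀ ω : Fin n → Bool, f ω * ∏ i, (1 + r * sg (x i) * sg (ω i))
      = ∑ S : Finset (Fin n), (r ^ #S * walsh S x) * (f ω * walsh S ω) := fun ω => by
    rw [prod_one_add, powerset_univ, mul_sum]
    refine sum_congr rfl fun S _ => ?_
    simp only [walsh, prod_mul_distrib, prod_const]
    ring
  simp only [noise, h, cubeE_sum, cubeE_mul_left, walshCoeff]
  exact sum_congr rfl fun S _ => by ring

theorem noise_one {n : ℕ} (f : (Fin n → Bool) → ℝ) : noise n 1 f = f := by
  funext x
  have h : ∀ ω : Fin n → Bool, f ω * ∏ i, (1 + 1 * sg (x i) * sg (ω i))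
      = if ω = x then f x * 2 ^ n else 0 := fun ω => by
    split_ifs with h
    · subst h
      simp only [one_mul, sg_mul_self]
      norm_num
    · obtain ⟨i, hi⟩ := Function.ne_iff.1 h
      rw [prod_eq_zero (mem_univ i), mul_zero]
      cases h1 : ω i <;> cases h2 : x i <;> simp_all [sg]
  simp only [noise, h, cubeE]
  simp

theorem sum_walshCoeff_mul_walsh {n : ℕ} (f : (Fin n → Bool) → ℝ) (x : Fin n → Bool) :
    ∑ S : Finset (Fin n), walshCoeff f S * walsh S x = f x := by
  conv_rhs => rw [← noise_one f, noise_eq_sum]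
  simp

theorem cubeE_mul {n : ℕ} (f g : (Fin n → Bool) → ℝ) :
    cubeE n (fun x => f x * g x) = ∑ S : Finset (Fin n), walshCoeff f S * walshCoeff g S := by
  have h : ∀ x, f x * g x = ∑ S : Finset (Fin n), walshCoeff g S * (f x * walsh S x) := fun x => by
    conv_lhs => rw [← sum_walshCoeff_mul_walsh g x, mul_sum]
    exact sum_congr rfl fun S _ => by ring
  simp only [h, cubeE_sum, cubeE_mul_left]
  exact sum_congr rfl fun S _ => mul_comm _ _

theorem cubeE_sq {n : ℕ} (f : (Fin n → Bool) → ℝ) :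
    cubeE n (fun x => f x ^ 2) = ∑ S : Finset (Fin n), walshCoeff f S ^ 2 := by
  simp only [sq, cubeE_mul]

theorem walshCoeff_empty {n : ℕ} (f : (Fin n → Bool) → ℝ) : walshCoeff f ∅ = cubeE n f := by
  simp [walshCoeff, walsh]

theorem walshCoeff_injective {n : ℕ} {f g : (Fin n → Bool) → ℝ}
    (h : ∀ S, walshCoeff f S = walshCoeff g S) : f = g := by
  funext x
  simp [← sum_walshCoeff_mul_walsh f x, ← sum_walshCoeff_mul_walsh g x, h]

theorem walshCoeff_noise {n : ℕ} (r : ℝ) (f : (Fin n → Bool) → ℝ) (S : Finset (Fin n)) :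
    walshCoeff (noise n r f) S = r ^ #S * walshCoeff f S := by
  have h : ∀ ω : Fin n → Bool,
      cubeE n (fun x => (∏ i, (1 + r * sg (x i) * sg (ω i))) * walsh S x)
        = r ^ #S * walsh S ω := fun ω => by
    simp only [walsh_eq_prod_ite, ← prod_mul_distrib]
    rw [cubeE_prod fun i b => (1 + r * sg b * sg (ω i)) * if i ∈ S then sg b else 1]
    have hr : r ^ #S = ∏ i, if i ∈ S then r else 1 := by simp
    rw [hr, ← prod_mul_distrib]
    refine prod_congr rfl fun i _ => ?_
    cases ω i <;> split_ifs <;> simp [sg] <;> ring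
  simp only [walshCoeff, noise, ← cubeE_mul_right, ← cubeE_mul_left]
  rw [cubeE_comm]
  congr 1
  funext ω
  simp only [mul_assoc, cubeE_mul_left] at h ⊢
  rw [h]
  ring

theorem walsh_cubeFlip {n : ℕ} (S : Finset (Fin n)) (i : Fin n) (x : Fin n → Bool) :
    walsh S (cubeFlip n i x) = (if i ∈ S then -1 else 1) * walsh S x := by
  simp only [walsh_eq_prod_ite]
  rw [← prod_erase_mul _ _ (mem_univ i), ← prod_erase_mul (a := i) univ
    (fun j => if j ∈ S then sg (x j) else 1) (mem_univ i)]
  have h : ∏ j ∈ univ.erase i, (if j ∈ S then sg (cubeFlip n i x j) else 1)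
      = ∏ j ∈ univ.erase i, (if j ∈ S then sg (x j) else 1) :=
    prod_congr rfl fun j hj => by simp [cubeFlip, Function.update_of_ne (ne_of_mem_erase hj)]
  rw [h]
  split_ifs
  · cases hx : x i <;> simp [cubeFlip, sg, hx]
  · simp

theorem walshCoeff_Dop {n : ℕ} (i : Fin n) (f : (Fin n → Bool) → ℝ) (S : Finset (Fin n)) :
    walshCoeff (Dop n i f) S = (if i ∈ S then -2 else 0) * walshCoeff f S := by
  have h := cubeE_comp_cubeFlip i fun x => f (cubeFlip n i x) * walsh S x
  simp only [cubeFlip_cubeFlip, walsh_cubeFlip] at h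
  have h' : ∀ x, Dop n i f x * walsh S x
      = f (cubeFlip n i x) * walsh S x + (-1) * (f x * walsh S x) := fun x => by
    rw [Dop]; ring
  simp only [walshCoeff, h']
  rw [cubeE_add, ← h, ← cubeE_add, ← cubeE_mul_left]
  congr 1
  funext x
  split_ifs <;> ring

theorem Dop_noise {n : ℕ} (i : Fin n) (r : ℝ) (f : (Fin n → Bool) → ℝ) :
    Dop n i (noise n r f) = noise n r (Dop n i f) :=
  walshCoeff_injective fun S => by
    rw [walshCoeff_Dop, walshCoeff_noise, walshCoeff_noise, walshCoeff_Dop]; ring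

theorem noise_noise {n : ℕ} (r s : ℝ) (f : (Fin n → Bool) → ℝ) :
    noise n r (noise n s f) = noise n (r * s) f :=
  walshCoeff_injective fun S => by
    rw [walshCoeff_noise, walshCoeff_noise, walshCoeff_noise, mul_pow]; ring

theorem sum_cubeE_Dop_sq {n : ℕ} (f : (Fin n → Bool) → ℝ) :
    ∑ i, cubeE n (fun x => Dop n i f x ^ 2)
      = 4 * ∑ S : Finset (Fin n), (#S : ℝ) * walshCoeff f S ^ 2 := by
  simp only [cubeE_sq, walshCoeff_Dop]
  rw [sum_comm, mul_sum]
  refine sum_congr rfl fun S _ => ?_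
  have h : ∀ i, ((if i ∈ S then (-2 : ℝ) else 0) * walshCoeff f S) ^ 2
      = if i ∈ S then 4 * walshCoeff f S ^ 2 else 0 := fun i => by split_ifs <;> ring
  simp only [h, sum_ite_mem, univ_inter, sum_const, nsmul_eq_mul]
  ring

theorem cubeVar_noise {n : ℕ} (r : ℝ) (f : (Fin n → Bool) → ℝ) :
    cubeVar n (noise n r f)
      = ∑ S ∈ univ.erase (∅ : Finset (Fin n)), (r ^ 2) ^ #S * walshCoeff f S ^ 2 := by
  rw [cubeVar, cubeE_sq, ← walshCoeff_empty, ← sum_erase_add _ _ (mem_univ ∅), add_sub_cancel_right]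
  exact sum_congr rfl fun S _ => by rw [walshCoeff_noise]; ring

/-- The noise operator is a contraction of `L¹`. -/
theorem cubeE_abs_noise_le {n : ℕ} {r : ℝ} (hr : |r| ≤ 1) (f : (Fin n → Bool) → ℝ) :
    cubeE n (fun x => |noise n r f x|) ≤ cubeE n (fun x => |f x|) := by
  have hK : ∀ x ω : Fin n → Bool, 0 ≤ ∏ i, (1 + r * sg (x i) * sg (ω i)) := fun x ω =>
    prod_nonneg fun i _ => by
      have : |r * sg (x i) * sg (ω i)| ≤ 1 := by simpa [abs_mul, abs_sg] using hr
      linarith [neg_le_of_abs_le this]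
  have h : ∀ x, |noise n r f x| ≤
      cubeE n (fun ω => |f ω| * ∏ i, (1 + r * sg (x i) * sg (ω i))) := fun x => by
    rw [abs_le]
    constructor
    · rw [neg_le, noise, neg_eq_neg_one_mul, ← cubeE_mul_left]
      refine cubeE_mono fun ω => ?_
      rw [← mul_assoc]
      exact mul_le_mul_of_nonneg_right (by linarith [neg_abs_le (f ω)]) (hK x ω)
    · exact cubeE_mono fun ω => mul_le_mul_of_nonneg_right (le_abs_self _) (hK x ω)
  refine (cubeE_mono h).trans_eq ?_
  rw [cubeE_comm]
  congr 1
  funext ω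
  rw [cubeE_mul_left, cubeE_prod fun i b => 1 + r * sg b * sg (ω i),
    prod_eq_one fun i _ => by simp only [sg]; cases ω i <;> simp <;> ring, mul_one]

theorem cubeE_succ {n : ℕ} (f : (Fin (n + 1) → Bool) → ℝ) :
    cubeE (n + 1) f
      = (cubeE n (fun x => f (Fin.cons true x)) + cubeE n (fun x => f (Fin.cons false x))) / 2 := by
  have h : ∑ x, f x = ∑ p : Bool × (Fin n → Bool), f (Fin.cons p.1 p.2) :=
    ((Fin.consEquiv fun _ : Fin (n + 1) => Bool).sum_comp f).symm
  simp only [cubeE, h, Fintype.sum_prod_type, Fintype.sum_bool, pow_succ]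
  field_simp

theorem noise_add {n : ℕ} (r : ℝ) (f g : (Fin n → Bool) → ℝ) (x : Fin n → Bool) :
    noise n r (fun y => f y + g y) x = noise n r f x + noise n r g x := by
  simp only [noise, add_mul, cubeE_add]

theorem noise_mul_left {n : ℕ} (r c : ℝ) (f : (Fin n → Bool) → ℝ) (x : Fin n → Bool) :
    noise n r (fun y => c * f y) x = c * noise n r f x := by
  simp only [noise, mul_assoc, cubeE_mul_left]

theorem noise_cons {n : ℕ} (r : ℝ) (f : (Fin (n + 1) → Bool) → ℝ) (b : Bool) (x : Fin n → Bool) :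
    noise (n + 1) r f (Fin.cons b x)
      = ((1 + r * sg b) * noise n r (fun y => f (Fin.cons true y)) x
        + (1 - r * sg b) * noise n r (fun y => f (Fin.cons false y)) x) / 2 := by
  simp only [noise, cubeE_succ, Fin.prod_univ_succ, Fin.cons_zero, Fin.cons_succ, ← cubeE_mul_left]
  congr 3 <;> funext ω <;> simp only [sg] <;> simp <;> ring

/-- Hypercontractivity of the noise operator from `L²` to `L⁴`. -/
theorem cubeE_noise_pow_four_le {r : ℝ} (hr : r ^ 2 ≤ 1 / 3) (n : ℕ) (f : (Fin n → Bool) → ℝ) :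
    cubeE n (fun x => noise n r f x ^ 4) ≤ cubeE n (fun x => f x ^ 2) ^ 2 := by
  induction n with
  | zero => simp [cubeE, noise]; exact le_of_eq (by ring)
  | succ n ih =>
    set a : (Fin n → Bool) → ℝ :=
      fun y => 1 / 2 * f (Fin.cons true y) + 1 / 2 * f (Fin.cons false y) with ha
    set b : (Fin n → Bool) → ℝ :=
      fun y => 1 / 2 * f (Fin.cons true y) + (-1 / 2) * f (Fin.cons false y) with hb
    have h₁ : cubeE (n + 1) (fun x => noise (n + 1) r f x ^ 4)
        = cubeE n (fun x => noise n r a x ^ 4)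
          + (6 * r ^ 2 * cubeE n (fun x => noise n r a x ^ 2 * noise n r b x ^ 2)
          + r ^ 4 * cubeE n (fun x => noise n r b x ^ 4)) := by
      rw [cubeE_succ, ← cubeE_add, ← cubeE_mul_left, ← cubeE_mul_left, ← cubeE_add, ← cubeE_add,
        div_eq_mul_inv, ← cubeE_mul_right]
      congr 1
      funext x
      simp only [noise_cons, ha, hb, noise_add, noise_mul_left, sg]
      norm_num
      ring
    have h₂ : cubeE (n + 1) (fun x => f x ^ 2)
        = cubeE n (fun x => a x ^ 2) + cubeE n (fun x => b x ^ 2) := by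
      rw [cubeE_succ, ← cubeE_add, ← cubeE_add, div_eq_mul_inv, ← cubeE_mul_right]
      congr 1
      funext x
      simp only [ha, hb]
      ring
    have hA : 0 ≤ cubeE n (fun x => a x ^ 2) := cubeE_nonneg fun x => sq_nonneg _
    have hB : 0 ≤ cubeE n (fun x => b x ^ 2) := cubeE_nonneg fun x => sq_nonneg _
    have hM : 0 ≤ cubeE n (fun x => noise n r a x ^ 2 * noise n r b x ^ 2) :=
      cubeE_nonneg fun x => by positivity
    have hM' : cubeE n (fun x => noise n r a x ^ 2 * noise n r b x ^ 2)
        ≤ cubeE n (fun x => a x ^ 2) * cubeE n (fun x => b x ^ 2) := by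
      refine (pow_le_pow_iff_left₀ hM (mul_nonneg hA hB) two_ne_zero).1 ?_
      refine (cubeE_mul_sq_le _ _).trans ?_
      simp only [← pow_mul, Nat.reduceMul]
      rw [mul_pow]
      exact mul_le_mul (ih a) (ih b) (cubeE_nonneg fun x => by positivity) (by positivity)
    have hb4 : 0 ≤ cubeE n (fun x => noise n r b x ^ 4) := cubeE_nonneg fun x => by positivity
    have hr4 : r ^ 4 ≤ 1 := by nlinarith [sq_nonneg r]
    rw [h₁, h₂]
    nlinarith [ih a, ih b, mul_le_mul_of_nonneg_right hr hM, mul_le_mul_of_nonneg_right hr4 hb4]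

/-- The `L^{4/3}` to `L²` hypercontractive estimate, interpolated between `L¹` and `L²`. -/
theorem cubeE_noise_sq_le {r : ℝ} (hr : r ^ 2 ≤ 1 / 3) {n : ℕ} (g : (Fin n → Bool) → ℝ) :
    cubeE n (fun x => noise n r g x ^ 2)
      ≤ cubeE n (fun x => |g x|) * √(cubeE n (fun x => g x ^ 2)) := by
  set X := cubeE n (fun x => noise n r g x ^ 2) with hX
  set h := noise n r (noise n r g) with hh
  have hX0 : 0 ≤ X := cubeE_nonneg fun x => sq_nonneg _
  have hG0 : 0 ≤ cubeE n (fun x => g x ^ 2) := cubeE_nonneg fun x => sq_nonneg _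
  have hL0 : 0 ≤ cubeE n (fun x => |g x|) := cubeE_nonneg fun x => abs_nonneg _
  have hP0 : 0 ≤ cubeE n (fun x => |g x| * h x ^ 2) := cubeE_nonneg fun x => by positivity
  have h₁ : X = cubeE n (fun x => g x * h x) := by
    rw [hX, cubeE_sq, cubeE_mul]
    exact sum_congr rfl fun S _ => by
      rw [hh, walshCoeff_noise r (noise n r g), walshCoeff_noise]; ring
  have h₂ : cubeE n (fun x => h x ^ 4) ≤ X ^ 2 := cubeE_noise_pow_four_le hr n _
  have h₃ : X ^ 2 ≤ cubeE n (fun x => |g x|) * cubeE n (fun x => |g x| * h x ^ 2) := by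
    have hcs := cubeE_mul_sq_le (fun x => √|g x|) (fun x => √|g x| * |h x|)
    simp only [mul_pow, Real.sq_sqrt (abs_nonneg _), sq_abs, ← mul_assoc,
      Real.mul_self_sqrt (abs_nonneg _), ← abs_mul] at hcs
    refine le_trans (pow_le_pow_left₀ hX0 ?_ 2) hcs
    exact h₁.le.trans (cubeE_mono fun x => le_abs_self _)
  have h₄ : cubeE n (fun x => |g x| * h x ^ 2) ^ 2 ≤ cubeE n (fun x => g x ^ 2) * X ^ 2 := by
    have hcs := cubeE_mul_sq_le (fun x => |g x|) (fun x => h x ^ 2)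
    simp only [← pow_mul, sq_abs] at hcs
    exact hcs.trans (mul_le_mul_of_nonneg_left h₂ hG0)
  have h₅ : cubeE n (fun x => |g x| * h x ^ 2) ≤ √(cubeE n (fun x => g x ^ 2)) * X := by
    refine (pow_le_pow_iff_left₀ hP0 (by positivity) two_ne_zero).1 ?_
    rwa [mul_pow, Real.sq_sqrt hG0]
  rcases hX0.eq_or_lt with h0 | h0
  · rw [← h0]; positivity
  · refine le_of_mul_le_mul_right ?_ h0
    calc X * X = X ^ 2 := (sq X).symm
      _ ≤ _ := h₃
      _ ≤ _ := mul_le_mul_of_nonneg_left h₅ hL0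
      _ = _ := by ring

theorem cubeVar_noise_le {r : ℝ} (hr : r ^ 2 ≤ 1) {n : ℕ} (f : (Fin n → Bool) → ℝ) :
    cubeVar n (noise n r f) ≤ cubeE n (fun x => f x ^ 2) := by
  rw [cubeVar_noise, cubeE_sq]
  refine le_trans (sum_le_sum fun S _ => ?_)
    (sum_le_sum_of_subset_of_nonneg (erase_subset ∅ univ) fun S _ _ => sq_nonneg _)
  exact mul_le_of_le_one_left (sq_nonneg _) (pow_le_one₀ (sq_nonneg r) hr)

/-- Talagrand-type bound on the variance of a sufficiently smoothed function. -/
theorem cubeVar_noise_le_sqrt {r : ℝ} (hr : r ^ 2 ≤ 1 / 6) {n : ℕ} (f : (Fin n → Bool) → ℝ) :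
    cubeVar n (noise n r f) ≤
      √((∑ i : Fin n, cubeE n (fun x => |Dop n i f x|) ^ 2) * cubeE n (fun x => f x ^ 2)) := by
  set A := ∑ i : Fin n, cubeE n (fun x => |Dop n i f x|) ^ 2 with hA
  set p : ℝ := √(1 / 3)
  have hp : p ^ 2 = 1 / 3 := Real.sq_sqrt (by norm_num)
  have hp0 : p ≠ 0 := fun h => by norm_num [h] at hp
  set q : ℝ := r / p with hq
  have hq2 : q ^ 2 ≤ 1 / 2 := by rw [hq, div_pow, hp]; linarith
  have hpq : p * q = r := by rw [hq]; field_simp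
  set g := noise n q f with hg
  have hq1 : |q| ≤ 1 := by rw [← sq_le_one_iff_abs_le_one]; linarith
  have hA0 : 0 ≤ A := sum_nonneg fun i _ => sq_nonneg _
  have hN0 : 0 ≤ cubeE n (fun x => f x ^ 2) := cubeE_nonneg fun x => sq_nonneg _
  have h₁ : 4 * cubeVar n (noise n r f) ≤ ∑ i, cubeE n (fun x => noise n p (Dop n i g) x ^ 2) := by
    simp only [← Dop_noise, hg, noise_noise, hpq]
    rw [sum_cubeE_Dop_sq, cubeVar_noise, ← sum_erase_add _ _ (mem_univ (∅ : Finset (Fin n)))]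
    simp only [card_empty, Nat.cast_zero, zero_mul, add_zero]
    refine mul_le_mul_of_nonneg_left (sum_le_sum fun S hS => ?_) (by norm_num)
    have hc : (1 : ℝ) ≤ #S := by
      exact_mod_cast card_pos.2 (nonempty_iff_ne_empty.2 (ne_of_mem_erase hS))
    rw [walshCoeff_noise, mul_pow, ← pow_mul, ← pow_mul, mul_comm 2, pow_mul]
    exact le_mul_of_one_le_left (by positivity) hc
  have h₂ : ∑ i, cubeE n (fun x => Dop n i g x ^ 2) ≤ 4 * cubeE n (fun x => f x ^ 2) := by
    rw [sum_cubeE_Dop_sq, cubeE_sq]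
    refine mul_le_mul_of_nonneg_left (sum_le_sum fun S _ => ?_) (by norm_num)
    rw [hg, walshCoeff_noise, mul_pow, ← mul_assoc]
    refine mul_le_of_le_one_left (sq_nonneg _) ?_
    rw [← pow_mul, mul_comm _ 2, pow_mul]
    calc (#S : ℝ) * (q ^ 2) ^ #S ≤ 2 ^ #S * (1 / 2) ^ #S := by
          gcongr
          exact_mod_cast Nat.lt_two_pow_self.le
      _ = 1 := by rw [← mul_pow]; norm_num
  have h₃ : ∑ i, cubeE n (fun x => noise n p (Dop n i g) x ^ 2)
      ≤ ∑ i, cubeE n (fun x => |Dop n i f x|) * √(cubeE n (fun x => Dop n i g x ^ 2)) := by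
    refine sum_le_sum fun i _ => (cubeE_noise_sq_le hp.le _).trans ?_
    refine mul_le_mul_of_nonneg_right ?_ (Real.sqrt_nonneg _)
    rw [hg, Dop_noise]
    exact cubeE_abs_noise_le hq1 _
  have h₄ : (∑ i, cubeE n (fun x => |Dop n i f x|) * √(cubeE n (fun x => Dop n i g x ^ 2))) ^ 2
      ≤ A * (4 * cubeE n (fun x => f x ^ 2)) := by
    refine (sum_mul_sq_le_sq_mul_sq _ _ _).trans (mul_le_mul_of_nonneg_left ?_ hA0)
    refine le_trans (le_of_eq (sum_congr rfl fun i _ => ?_)) h₂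
    exact Real.sq_sqrt (cubeE_nonneg fun x => sq_nonneg _)
  have h₅ := Real.le_sqrt_of_sq_le h₄
  have h₆ : √(A * (4 * cubeE n (fun x => f x ^ 2))) = 2 * √(A * cubeE n (fun x => f x ^ 2)) := by
    rw [show A * (4 * cubeE n (fun x => f x ^ 2)) = 2 ^ 2 * (A * cubeE n (fun x => f x ^ 2)) by ring,
      Real.sqrt_mul (by norm_num), Real.sqrt_sq (by norm_num)]
  have := Real.sqrt_nonneg (A * cubeE n (fun x => f x ^ 2))
  linarith

/-- Hölder's inequality for a sum of powers with nonnegative weights. -/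
theorem sum_mul_rpow_le {ι : Type*} (s : Finset ι) {w y : ι → ℝ} {N V t : ℝ}
    (hw : ∀ i ∈ s, 0 ≤ w i) (hy : ∀ i ∈ s, 0 ≤ y i) (hN : ∑ i ∈ s, w i ≤ N)
    (hV : ∑ i ∈ s, y i * w i ≤ V) (hN0 : 0 < N) (hV0 : 0 < V) (ht0 : 0 ≤ t) (ht1 : t ≤ 1) :
    ∑ i ∈ s, y i ^ t * w i ≤ N * (V / N) ^ t := by
  have h : ∀ i ∈ s, y i ^ t * w i
      ≤ (V / N) ^ t * ((1 - t) * w i + t * (y i * w i / (V / N))) := fun i hi => by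
    have hc : 0 < V / N := div_pos hV0 hN0
    have hz : 0 ≤ y i / (V / N) := div_nonneg (hy i hi) hc.le
    have hg := Real.geom_mean_le_arith_mean2_weighted (sub_nonneg.2 ht1) ht0 zero_le_one hz (by ring)
    rw [Real.one_rpow, one_mul, Real.div_rpow (hy i hi) hc.le,
      div_le_iff₀ (Real.rpow_pos_of_pos hc t)] at hg
    calc y i ^ t * w i ≤ _ := mul_le_mul_of_nonneg_right hg (hw i hi)
      _ = _ := by ring
  refine (sum_le_sum h).trans ?_
  rw [← mul_sum, sum_add_distrib, ← mul_sum, ← mul_sum, ← sum_div, mul_comm]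
  refine mul_le_mul_of_nonneg_right ?_ (by positivity)
  have h' : (∑ i ∈ s, y i * w i) / (V / N) ≤ N := by
    rw [div_le_iff₀ (by positivity), mul_div_cancel₀ _ hN0.ne']
    exact hV
  nlinarith

end CubeFourier

/-- for every `n ≥ 1`, `f : {-1,1}ⁿ → ℝ` and `t ≥ 0`,
`Var_ν (T_t f) ≤ 7 (∑ ‖D_i f‖₁²)^{(1-e^{-t})/2} ‖f‖₂^{1+e^{-t}}`. -/
theorem stmt0 (n : ℕ) (hn : 1 ≤ n) (f : (Fin n → Bool) → ℝ) (t : ℝ) (ht : 0 ≤ t) :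
    cubeVar n (Tt n t f) ≤
      7 * (∑ i : Fin n, (cubeE n fun x => |Dop n i f x|) ^ 2) ^ ((1 - Real.exp (-t)) / 2) *
        ((cubeE n fun x => f x ^ 2) ^ ((1 : ℝ) / 2)) ^ (1 + Real.exp (-t)) := by
  have hNn : 0 ≤ cubeE n (fun x => f x ^ 2) := cubeE_nonneg fun x => sq_nonneg _
  have hAn : 0 ≤ ∑ i : Fin n, (cubeE n fun x => |Dop n i f x|) ^ 2 :=
    sum_nonneg fun i _ => sq_nonneg _
  have hV1 : cubeVar n (noise n (Real.exp (-1)) f) ≤ _ := cubeVar_noise_le_sqrt (by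
    rw [← Real.exp_nat_mul, show ((2 : ℕ) : ℝ) * -1 = -2 by norm_num, Real.exp_neg, one_div]
    refine inv_anti₀ (by norm_num) ?_
    rw [show (2 : ℝ) = 1 + 1 by norm_num, Real.exp_add]
    nlinarith [Real.exp_one_gt_d9]) f
  have hVN : cubeVar n (Tt n t f) ≤ _ := cubeVar_noise_le (r := Real.exp (-t)) (by
    rw [sq_le_one_iff₀ (Real.exp_pos _).le]; simpa using ht) f
  rw [← Real.rpow_mul hNn]
  set A := ∑ i : Fin n, (cubeE n fun x => |Dop n i f x|) ^ 2
  set N := cubeE n (fun x => f x ^ 2) with hN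
  set θ := (1 - Real.exp (-t)) / 2 with hθ
  have hθe : 1 / 2 * (1 + Real.exp (-t)) = 1 - θ := by rw [hθ]; ring
  have hexp : Real.exp (-t) ≤ 1 := by simpa using ht
  have hθ0 : 0 ≤ θ := by rw [hθ]; linarith
  rw [hθe]
  suffices h : cubeVar n (Tt n t f) ≤ A ^ θ * N ^ (1 - θ) by
    have : 0 ≤ A ^ θ * N ^ (1 - θ) := by positivity
    linarith
  rcases hNn.eq_or_lt with hN0 | hN0
  · exact (hVN.trans hN0.ge).trans (by positivity)
  have hsplit : A ^ θ * N ^ (1 - θ) = N * (A / N) ^ θ := by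
    rw [Real.div_rpow hAn hNn, Real.rpow_sub hN0, Real.rpow_one]; ring
  rw [hsplit]
  rcases le_total N A with hNA | hAN
  · exact hVN.trans (le_mul_of_one_le_right hNn (Real.one_le_rpow ((one_le_div hN0).2 hNA) hθ0))
  set V := cubeVar n (noise n (Real.exp (-1)) f) with hV
  have hV1' : V ≤ N * (A / N) ^ ((1 : ℝ) / 2) := by
    refine hV1.trans_eq ?_
    rw [← Real.sqrt_eq_rpow, ← Real.sqrt_sq hNn, ← Real.sqrt_mul (sq_nonneg _), Real.sqrt_sq hNn]
    congr 1
    field_simp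
  have hy : ∀ S : Finset (Fin n),
      (Real.exp (-t) ^ 2) ^ #S = ((Real.exp (-1) ^ 2) ^ #S) ^ t := fun S => by
    simp only [← Real.exp_nat_mul, ← Real.exp_mul]
    congr 1
    ring
  have hVt : cubeVar n (Tt n t f) = ∑ S ∈ univ.erase (∅ : Finset (Fin n)),
      ((Real.exp (-1) ^ 2) ^ #S) ^ t * walshCoeff f S ^ 2 := by
    simp only [← hy]
    exact cubeVar_noise _ f
  rw [cubeVar_noise] at hV
  have hV0 : 0 ≤ V := hV ▸ sum_nonneg fun S _ => by positivity
  rcases hV0.eq_or_lt with hV0 | hV0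
  · rw [← hV0] at hV
    have hz := (sum_eq_zero_iff_of_nonneg fun S _ => by positivity).1 hV.symm
    rw [hVt, sum_eq_zero fun S hS => by
      rw [(mul_eq_zero_iff_left (by positivity)).1 (hz S hS), mul_zero]]
    positivity
  have hA0 : 0 < A := by
    refine hAn.lt_of_ne fun h => ?_
    rw [← h, zero_mul, Real.sqrt_zero] at hV1
    exact absurd hV0 hV1.not_gt
  have hAN0 : 0 < A / N := div_pos hA0 hN0
  have hAN1 : A / N ≤ 1 := (div_le_one hN0).2 hAN
  rcases le_total t 1 with ht1 | ht1
  · have hWN : ∑ S ∈ univ.erase (∅ : Finset (Fin n)), walshCoeff f S ^ 2 ≤ N := by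
      rw [hN, cubeE_sq]
      exact sum_le_sum_of_subset_of_nonneg (erase_subset ∅ univ) fun S _ _ => sq_nonneg _
    rw [hVt]
    refine (sum_mul_rpow_le _ (fun S _ => sq_nonneg _) (fun S _ => by positivity) hWN hV.ge hN0 hV0
      ht ht1).trans (mul_le_mul_of_nonneg_left ?_ hNn)
    calc (V / N) ^ t ≤ ((A / N) ^ ((1 : ℝ) / 2)) ^ t := by
          refine Real.rpow_le_rpow (by positivity) ?_ ht
          rwa [div_le_iff₀' hN0]
      _ = (A / N) ^ (1 / 2 * t) := (Real.rpow_mul hAN0.le _ _).symm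
      _ ≤ (A / N) ^ θ := by
          refine Real.rpow_le_rpow_of_exponent_ge hAN0 hAN1 ?_
          rw [hθ]
          linarith [Real.add_one_le_exp (-t)]
  · calc cubeVar n (Tt n t f) ≤ V := by
          rw [hVt, hV]
          refine sum_le_sum fun S _ => mul_le_mul_of_nonneg_right ?_ (sq_nonneg _)
          rw [← hy]
          gcongr
      _ ≤ _ := hV1'
      _ ≤ _ := by
          refine mul_le_mul_of_nonneg_left ?_ hNn
          refine Real.rpow_le_rpow_of_exponent_ge hAN0 hAN1 ?_
          rw [hθ]
          linarith [Real.exp_pos (-t)]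
end

section
/- There exists a universal constant C > 0 with the following property. For every m ≥ 2, every n ≥ 1, every f : (ℤ/mℤ)^n → {0,1}, and every ε ∈ (0,1), letting 𝕀 = m^{−n} Σ_{i=1}^n Σ_{x ∈ (ℤ/mℤ)^n} |f(x + e_i) − f(x)| be the total influence of f, there exists a function g : (ℤ/mℤ)^n → ℝ depending on at most exp(C · 𝕀 m² log(m²/ε) / ε) coordinates such that ‖f − g‖₁ := m^{−n} Σ_{x ∈ (ℤ/mℤ)^n} |f(x) − g(x)| ≤ ε. -/
open Finset

/-- `g` depends on at most `k` (a real bound) coordinates. -/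
def DependsOnAtMost {m : ℕ} [NeZero m] (n : ℕ) (g : (Fin n → ZMod m) → ℝ) (k : ℝ) : Prop :=
  ∃ J : Finset (Fin n), (J.card : ℝ) ≤ k ∧
    ∀ x y : Fin n → ZMod m, (∀ j ∈ J, x j = y j) → g x = g y

/-- The kernel on `ℤ/mℤ` acting as `a` on constants and as `b` on functions of mean zero. -/
noncomputable def meanKernel (m : ℕ) (a b : ℝ) (x y : ZMod m) : ℝ :=
  a / m + b * ((if x = y then 1 else 0) - 1 / m)

section Kernel

variable {m : ℕ}

lemma meanKernel_comm (a b : ℝ) (x y : ZMod m) :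
    meanKernel m a b x y = meanKernel m a b y x := by
  simp only [meanKernel, eq_comm]

lemma meanKernel_one_one (x y : ZMod m) :
    meanKernel m 1 1 x y = if x = y then 1 else 0 := by
  simp only [meanKernel]; ring

lemma meanKernel_eq_add (a b : ℝ) (x y : ZMod m) :
    meanKernel m a b x y = b * meanKernel m 0 1 x y + a * meanKernel m 1 0 x y := by
  simp only [meanKernel]; ring

lemma meanKernel_nonneg {b : ℝ} (h0 : 0 ≤ b) (h1 : b ≤ 1) (x y : ZMod m) :
    0 ≤ meanKernel m 1 b x y := by
  have h : meanKernel m 1 b x y = (1 - b) / m + b * (if x = y then 1 else 0) := by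
    simp only [meanKernel]; ring
  rw [h]
  have : 0 ≤ 1 - b := by linarith
  positivity

variable [NeZero m]

lemma sum_meanKernel_mul (a b : ℝ) (x : ZMod m) (s : ZMod m → ℝ) :
    ∑ y, meanKernel m a b x y * s y = a * ((∑ y, s y) / m) + b * (s x - (∑ y, s y) / m) := by
  have h (y : ZMod m) : meanKernel m a b x y * s y =
      (a - b) / m * s y + b * (if x = y then s y else 0) := by
    simp only [meanKernel]; split_ifs <;> ring
  simp only [h, sum_add_distrib, ← mul_sum, sum_ite_eq, mem_univ, if_true]
  ring

lemma sum_meanKernel (a b : ℝ) (y : ZMod m) : ∑ x, meanKernel m a b x y = a := by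
  have hm : (m : ℝ) ≠ 0 := NeZero.ne _
  have h := sum_meanKernel_mul a b y (fun _ => 1)
  simp only [mul_one, sum_const, card_univ, ZMod.card, nsmul_eq_mul, div_self hm, sub_self,
    mul_zero, add_zero] at h
  simpa only [meanKernel_comm] using h

lemma sum_meanKernel_mul_meanKernel (a b a' b' : ℝ) (x z : ZMod m) :
    ∑ y, meanKernel m a b x y * meanKernel m a' b' y z = meanKernel m (a * a') (b * b') x z := by
  rw [sum_meanKernel_mul, sum_meanKernel]
  simp only [meanKernel]; ring

/-- One-coordinate `(2, 4)`-hypercontractivity. -/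
lemma sum_meanKernel_pow_four_le (hm : 2 ≤ m) (s : ZMod m → ℝ) :
    m * ∑ x, (∑ y, meanKernel m 1 (1 / m) x y * s y) ^ 4 ≤ (∑ x, s x ^ 2) ^ 2 := by
  have hm2 : (2 : ℝ) ≤ m := by exact_mod_cast hm
  have hm0 : (m : ℝ) ≠ 0 := by positivity
  simp only [sum_meanKernel_mul]
  set A := (∑ y, s y) / m with hA
  set ρ : ℝ := 1 / m with hρ
  set H : ZMod m → ℝ := fun x => s x - A with hH
  have hsum : ∑ x, s x = m * A := by rw [hA]; field_simp
  have hH0 : ∑ x, H x = 0 := by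
    simp [hH, sum_sub_distrib, hsum, ZMod.card]
  set V := ∑ x, H x ^ 2 with hV
  have hV0 : 0 ≤ V := sum_nonneg fun _ _ => sq_nonneg _
  have hs2 : ∑ x, s x ^ 2 = m * A ^ 2 + V := by
    have : ∀ x, s x ^ 2 = A ^ 2 + 2 * A * H x + H x ^ 2 := fun x => by simp only [hH]; ring
    simp only [this, sum_add_distrib, ← mul_sum, hH0, sum_const, card_univ, ZMod.card,
      nsmul_eq_mul]
    ring
  have hH4 : ∑ x, H x ^ 4 ≤ V ^ 2 := by
    have : ∀ x ∈ univ, H x ^ 4 ≤ V * H x ^ 2 := fun x hx => by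
      have : H x ^ 2 ≤ V := single_le_sum (f := fun x => H x ^ 2) (fun _ _ => sq_nonneg _) hx
      nlinarith [sq_nonneg (H x)]
    calc _ ≤ _ := sum_le_sum this
      _ = V ^ 2 := by rw [← mul_sum]; ring
  have hpt : ∀ x ∈ univ, (1 * A + ρ * (s x - A)) ^ 4 ≤
      A ^ 4 + 4 * ρ * A ^ 3 * H x + 8 * ρ ^ 2 * A ^ 2 * H x ^ 2 + 3 * ρ ^ 4 * H x ^ 4 := by
    intro x _
    change (1 * A + ρ * H x) ^ 4 ≤ _
    nlinarith [mul_nonneg (sq_nonneg (ρ * H x)) (sq_nonneg (A - ρ * H x))]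
  have hle := sum_le_sum hpt
  simp only [sum_add_distrib, ← mul_sum, hH0, ← hV, sum_const, card_univ, ZMod.card,
      nsmul_eq_mul] at hle
  have h1 : m * (8 * ρ ^ 2) ≤ 2 * (m : ℝ) := by
    rw [hρ]; field_simp; nlinarith
  have h2 : m * (3 * ρ ^ 4) ≤ 1 := by
    rw [hρ]; field_simp; nlinarith [mul_nonneg (sub_nonneg.2 hm2) (sub_nonneg.2 hm2)]
  rw [hs2]
  have hρ4 : 0 ≤ m * (3 * ρ ^ 4) := by positivity
  calc _ ≤ (m : ℝ) * (m * A ^ 4 + 4 * ρ * A ^ 3 * 0 + 8 * ρ ^ 2 * A ^ 2 * V +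
        3 * ρ ^ 4 * ∑ x, H x ^ 4) := by gcongr
    _ = m ^ 2 * A ^ 4 + (m * (8 * ρ ^ 2)) * (A ^ 2 * V) + m * (3 * ρ ^ 4) * ∑ x, H x ^ 4 := by
        ring
    _ ≤ m ^ 2 * A ^ 4 + (2 * m) * (A ^ 2 * V) + 1 * V ^ 2 := by gcongr
    _ = _ := by ring

end Kernel

/-- Minkowski's inequality in `L⁴`, with prescribed bounds on the norms. -/
lemma mul_sum_sum_pow_four_le {ι X : Type*} [Fintype ι] [Fintype X] {c : ℝ} (hc : 0 < c)
    (k s : ι → ℝ) (u : ι → X → ℝ) (hk : ∀ b, 0 ≤ k b) (hs : ∀ b, 0 ≤ s b)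
    (h : ∀ b, c * ∑ x, u b x ^ 4 ≤ s b ^ 4) :
    c * ∑ x, (∑ b, k b * u b x) ^ 4 ≤ (∑ b, k b * s b) ^ 4 := by
  have hu (b : ι) (hb : s b = 0) (x : X) : u b x = 0 := by
    have h1 : ∑ x, u b x ^ 4 ≤ 0 := by
      have := h b
      rw [hb] at this
      nlinarith
    have h2 := (sum_eq_zero_iff_of_nonneg (fun x _ => by positivity)).1
      (le_antisymm h1 (sum_nonneg fun x _ => by positivity)) x (mem_univ x)
    exact pow_eq_zero_iff (by norm_num) |>.1 h2
  set σ := ∑ b, k b * s b with hσ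
  have hσ0 : 0 ≤ σ := sum_nonneg fun b _ => mul_nonneg (hk b) (hs b)
  rcases hσ0.eq_or_lt with h0 | h0
  · have hz : ∀ x, ∑ b, k b * u b x = 0 := fun x => sum_eq_zero fun b hb => by
      have := (sum_eq_zero_iff_of_nonneg fun b _ => mul_nonneg (hk b) (hs b)).1 h0.symm b hb
      rcases mul_eq_zero.1 this with h' | h'
      · simp [h']
      · simp [hu b h']
    simp [hz, ← h0]
  · have hpt : ∀ x, (∑ b, k b * u b x) ^ 4 ≤ ∑ b, σ ^ 3 * (k b * (s b * (u b x / s b) ^ 4)) := by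
      intro x
      have h1 : ∑ b, k b * u b x = σ * ∑ b, k b * s b / σ * (u b x / s b) := by
        rw [mul_sum]
        refine sum_congr rfl fun b _ => ?_
        rcases eq_or_ne (s b) 0 with hb | hb
        · simp [hu b hb x]
        · field_simp
      have h2 := Real.pow_arith_mean_le_arith_mean_pow_of_even univ
        (fun b => k b * s b / σ) (fun b => u b x / s b)
        (fun b _ => div_nonneg (mul_nonneg (hk b) (hs b)) hσ0)
        (by rw [← sum_div, ← hσ, div_self h0.ne']) (n := 4) (by decide)
      rw [h1, mul_pow]
      calc _ ≤ σ ^ 4 * _ := mul_le_mul_of_nonneg_left h2 (by positivity)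
        _ = _ := by
          rw [mul_sum]
          refine sum_congr rfl fun b _ => ?_
          field_simp
    calc _ ≤ c * ∑ x, ∑ b, σ ^ 3 * (k b * (s b * (u b x / s b) ^ 4)) := by
          gcongr with x; exact hpt x
      _ = ∑ b, σ ^ 3 * (k b * (s b * (c * (∑ x, u b x ^ 4) / s b ^ 4))) := by
          rw [sum_comm, mul_sum]
          refine sum_congr rfl fun b _ => ?_
          simp only [div_pow, ← mul_sum, ← sum_div]
          ring
      _ ≤ ∑ b, σ ^ 3 * (k b * (s b * 1)) := by
          gcongr with b
          · exact hk b
          · exact hs b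
          · exact div_le_one_of_le₀ (h b) (by have := hs b; positivity)
      _ = σ ^ 4 := by simp only [mul_one, ← mul_sum, ← hσ]; ring

/-- The tensor product of mean kernels, acting on functions on the discrete torus. -/
noncomputable def torusOp {m : ℕ} [NeZero m] {n : ℕ} (a b : Fin n → ℝ)
    (f : (Fin n → ZMod m) → ℝ) (x : Fin n → ZMod m) : ℝ :=
  ∑ y, (∏ i, meanKernel m (a i) (b i) (x i) (y i)) * f y

section TorusOp

variable {m : ℕ} [NeZero m] {n : ℕ}

lemma torusOp_torusOp (a b a' b' : Fin n → ℝ) (f : (Fin n → ZMod m) → ℝ) :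
    torusOp a b (torusOp a' b' f) = torusOp (a * a') (b * b') f := by
  ext x
  simp only [torusOp, mul_sum]
  rw [sum_comm]
  refine sum_congr rfl fun z _ => ?_
  simp only [← mul_assoc, ← prod_mul_distrib, ← sum_mul, Pi.mul_apply,
    ← sum_meanKernel_mul_meanKernel, Fintype.prod_sum]

lemma sum_mul_torusOp (a b : Fin n → ℝ) (f g : (Fin n → ZMod m) → ℝ) :
    ∑ x, f x * torusOp a b g x = ∑ x, torusOp a b f x * g x := by
  simp only [torusOp, mul_sum, sum_mul]
  rw [sum_comm]
  refine sum_congr rfl fun y _ => sum_congr rfl fun x _ => ?_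
  rw [prod_congr rfl fun i _ => meanKernel_comm (a i) (b i) (x i) (y i)]
  ring

lemma sum_torusOp_sq (a b : Fin n → ℝ) (f : (Fin n → ZMod m) → ℝ) :
    ∑ x, torusOp a b f x ^ 2 = ∑ x, f x * torusOp (a * a) (b * b) f x := by
  simp only [sq, ← torusOp_torusOp, sum_mul_torusOp]

lemma torusOp_one_one (f : (Fin n → ZMod m) → ℝ) : torusOp 1 1 f = f := by
  ext x
  simp only [torusOp, Pi.one_apply, meanKernel_one_one, prod_ite_zero, mem_univ, forall_const,
    prod_const_one, ← funext_iff, ite_mul, one_mul, zero_mul, sum_ite_eq, if_true]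

/-- The Efron–Stein weight (unnormalized) of `f` on the set `S` of coordinates. -/
noncomputable def efronSteinWeight (f : (Fin n → ZMod m) → ℝ) (S : Finset (Fin n)) : ℝ :=
  ∑ x, f x * torusOp (fun i => if i ∈ S then 0 else 1) (fun i => if i ∈ S then 1 else 0) f x

lemma efronSteinWeight_nonneg (f : (Fin n → ZMod m) → ℝ) (S : Finset (Fin n)) :
    0 ≤ efronSteinWeight f S := by
  have h : efronSteinWeight f S = ∑ x, torusOp (fun i => if i ∈ S then 0 else 1)
      (fun i => if i ∈ S then 1 else 0) f x ^ 2 := by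
    rw [sum_torusOp_sq, efronSteinWeight]
    have h0 : (fun i => if i ∈ S then (0 : ℝ) else 1) * (fun i => if i ∈ S then (0 : ℝ) else 1) =
        fun i => if i ∈ S then 0 else 1 := by ext i; simp
    have h1 : (fun i => if i ∈ S then (1 : ℝ) else 0) * (fun i => if i ∈ S then (1 : ℝ) else 0) =
        fun i => if i ∈ S then 1 else 0 := by ext i; simp
    rw [h0, h1]
  rw [h]
  positivity

lemma sum_mul_torusOp_self (a b : Fin n → ℝ) (f : (Fin n → ZMod m) → ℝ) :
    ∑ x, f x * torusOp a b f x =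
      ∑ S, (∏ i, if i ∈ S then b i else a i) * efronSteinWeight f S := by
  have h (x y : Fin n → ZMod m) : ∏ i, meanKernel m (a i) (b i) (x i) (y i) =
      ∑ S : Finset (Fin n), (∏ i, if i ∈ S then b i else a i) *
        ∏ i, meanKernel m (if i ∈ S then 0 else 1) (if i ∈ S then 1 else 0) (x i) (y i) := by
    rw [prod_congr rfl fun i _ => meanKernel_eq_add (a i) (b i) (x i) (y i), Fintype.prod_add]
    refine sum_congr rfl fun S _ => ?_
    rw [← prod_mul_distrib]
    rw [← Finset.prod_mul_prod_compl S fun i => (if i ∈ S then b i else a i) * _]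
    congr 1
    · exact prod_congr rfl fun i hi => by simp [hi]
    · exact prod_congr rfl fun i hi => by simp [mem_compl.1 hi]
  simp only [efronSteinWeight, torusOp, h, mul_sum, sum_mul]
  conv_rhs => rw [sum_comm]
  refine sum_congr rfl fun x _ => ?_
  conv_rhs => rw [sum_comm]
  refine sum_congr rfl fun y _ => sum_congr rfl fun S _ => ?_
  ring

lemma torusOp_cons (a b : ℝ) (f : (Fin (n + 1) → ZMod m) → ℝ) (c : ZMod m)
    (x : Fin n → ZMod m) :
    torusOp (fun _ => a) (fun _ => b) f (Fin.cons c x : Fin (n + 1) → ZMod m) =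
      ∑ d, meanKernel m a b c d *
        torusOp (fun _ => a) (fun _ => b) (fun y => f (Fin.cons d y : Fin (n + 1) → ZMod m)) x := by
  simp only [torusOp]
  rw [← (Fin.consEquiv fun _ => ZMod m).sum_comp, Fintype.sum_prod_type]
  refine sum_congr rfl fun d _ => ?_
  rw [mul_sum]
  refine sum_congr rfl fun y _ => ?_
  simp [Fin.consEquiv, Fin.prod_univ_succ, mul_assoc]

/-- `(2, 4)`-hypercontractivity on the discrete torus. -/
lemma sum_torusOp_pow_four_le (hm : 2 ≤ m) (n : ℕ) (f : (Fin n → ZMod m) → ℝ) :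
    (m : ℝ) ^ n * ∑ x, torusOp (fun _ => 1) (fun _ => 1 / (m : ℝ)) f x ^ 4 ≤
      (∑ x, f x ^ 2) ^ 2 := by
  have hm0 : (0 : ℝ) < m := by positivity
  have hm1 : 1 / (m : ℝ) ≤ 1 := by
    rw [div_le_one hm0]; exact_mod_cast (by omega : 1 ≤ m)
  induction n with
  | zero =>
    simp [torusOp, ← pow_mul]
  | succ n ih =>
    rw [← (Fin.consEquiv fun _ => ZMod m).sum_comp, ← (Fin.consEquiv fun _ => ZMod m).sum_comp,
      Fintype.sum_prod_type, Fintype.sum_prod_type]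
    simp only [Fin.consEquiv, Equiv.coe_fn_mk, torusOp_cons]
    set s : ZMod m → ℝ := fun d => √(∑ y, f (Fin.cons d y : Fin (n + 1) → ZMod m) ^ 2) with hs
    have hs2 (d : ZMod m) : s d ^ 2 = ∑ y, f (Fin.cons d y : Fin (n + 1) → ZMod m) ^ 2 :=
      Real.sq_sqrt (by positivity)
    have key (c : ZMod m) := mul_sum_sum_pow_four_le (c := (m : ℝ) ^ n) (by positivity)
      (meanKernel m 1 (1 / m) c) s
      (fun d => torusOp (fun _ => 1) (fun _ => 1 / (m : ℝ))
        fun y => f (Fin.cons d y : Fin (n + 1) → ZMod m))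
      (meanKernel_nonneg (by positivity) hm1 c) (fun d => Real.sqrt_nonneg _)
      (fun d => by
        rw [show s d ^ 4 = (s d ^ 2) ^ 2 by ring, hs2]
        exact ih _)
    calc _ = (m : ℝ) * ∑ c, ((m : ℝ) ^ n * ∑ x, (∑ d, meanKernel m 1 (1 / m) c d *
          torusOp (fun _ => 1) (fun _ => 1 / (m : ℝ))
            (fun y => f (Fin.cons d y : Fin (n + 1) → ZMod m)) x) ^ 4) := by
          rw [← mul_sum]; ring
      _ ≤ (m : ℝ) * ∑ c, (∑ d, meanKernel m 1 (1 / m) c d * s d) ^ 4 := by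
          gcongr with c; exact key c
      _ ≤ (∑ d, s d ^ 2) ^ 2 := sum_meanKernel_pow_four_le hm s
      _ = _ := by simp only [hs2]


/-- The component of `f` of mean zero in the `i`-th coordinate. -/
noncomputable def coordDeviation (i : Fin n) (f : (Fin n → ZMod m) → ℝ) :
    (Fin n → ZMod m) → ℝ :=
  torusOp (fun j => if j = i then 0 else 1) 1 f

lemma coordDeviation_apply (i : Fin n) (f : (Fin n → ZMod m) → ℝ) (x : Fin n → ZMod m) :
    coordDeviation i f x = (∑ c, (f x - f (x + Pi.single i c))) / m := by
  have hm : (m : ℝ) ≠ 0 := NeZero.ne _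
  have hprod (y : Fin n → ZMod m) :
      ∏ j, meanKernel m (if j = i then 0 else 1) 1 (x j) (y j) =
        ∑ c, if y = x + Pi.single i c then meanKernel m 0 1 (x i) (x i + c) else 0 := by
    by_cases h : ∃ c, y = x + Pi.single i c
    · obtain ⟨c, rfl⟩ := h
      rw [Fintype.prod_eq_single i fun j hj => by simp [hj, meanKernel_one_one],
        Fintype.sum_eq_single c fun c' hc' => if_neg ?_]
      · simp
      · simpa [Pi.single_inj] using hc'.symm
    · rw [sum_eq_zero fun c _ => if_neg fun hc => h ⟨c, hc⟩]
      have : ∃ j, j ≠ i ∧ x j ≠ y j := by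
        by_contra! hj
        refine h ⟨y i - x i, funext fun j => ?_⟩
        rcases eq_or_ne j i with rfl | hji
        · simp
        · simp [hji, hj j hji]
      obtain ⟨j, hji, hj⟩ := this
      exact prod_eq_zero (mem_univ j) (by simp [hji, hj, meanKernel_one_one])
  simp only [coordDeviation, torusOp, Pi.one_apply, hprod, sum_mul, ite_mul, zero_mul]
  rw [sum_comm]
  simp only [sum_ite_eq', mem_univ, if_true, meanKernel, left_eq_add]
  simp only [zero_div, zero_add, one_mul, sub_mul, ite_mul, zero_mul, sum_sub_distrib, sum_ite_eq',
    mem_univ, if_true, Pi.single_zero, add_zero, sum_const, card_univ, ZMod.card,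
    nsmul_eq_mul, ← mul_sum]
  field_simp

/-- The influence (unnormalized) of the `i`-th coordinate on `f`. -/
noncomputable def torusInfluence (f : (Fin n → ZMod m) → ℝ) (i : Fin n) : ℝ :=
  ∑ x, |f (x + Pi.single i 1) - f x|

lemma sum_abs_sub_add_single_le (f : (Fin n → ZMod m) → ℝ) (i : Fin n) (k : ℕ) :
    ∑ x, |f x - f (x + Pi.single i (k : ZMod m))| ≤ k * torusInfluence f i := by
  induction k with
  | zero => simp
  | succ k ih =>
    have h : ∑ x : Fin n → ZMod m,
        |f (x + Pi.single i (k : ZMod m)) - f (x + Pi.single i ((k + 1 : ℕ) : ZMod m))| =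
        torusInfluence f i := by
      refine Eq.trans ?_ (Equiv.sum_comp (Equiv.addRight (Pi.single i (k : ZMod m)))
        fun x => |f (x + Pi.single i 1) - f x|)
      refine sum_congr rfl fun x _ => ?_
      rw [abs_sub_comm, Nat.cast_succ, Pi.single_add]
      simp [add_assoc]
    calc _ ≤ ∑ x, (|f x - f (x + Pi.single i (k : ZMod m))| +
          |f (x + Pi.single i (k : ZMod m)) - f (x + Pi.single i ((k + 1 : ℕ) : ZMod m))|) :=
          sum_le_sum fun x _ => abs_sub_le _ _ _
      _ ≤ k * torusInfluence f i + torusInfluence f i := by rw [sum_add_distrib, h]; gcongr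
      _ = _ := by push_cast; ring

lemma torusInfluence_nonneg (f : (Fin n → ZMod m) → ℝ) (i : Fin n) : 0 ≤ torusInfluence f i :=
  sum_nonneg fun _ _ => abs_nonneg _

lemma sum_abs_coordDeviation_le (f : (Fin n → ZMod m) → ℝ) (i : Fin n) :
    ∑ x, |coordDeviation i f x| ≤ m * torusInfluence f i := by
  have hm : (0 : ℝ) < m := by exact_mod_cast Nat.pos_of_neZero m
  have hD := torusInfluence_nonneg f i
  calc _ ≤ ∑ x, (∑ c, |f x - f (x + Pi.single i c)|) / m := by
        gcongr with x
        rw [coordDeviation_apply, abs_div, abs_of_pos hm]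
        gcongr
        exact abs_sum_le_sum_abs _ _
    _ = (∑ c, ∑ x, |f x - f (x + Pi.single i c)|) / m := by rw [← sum_div, sum_comm]
    _ ≤ (∑ _c : ZMod m, m * torusInfluence f i) / m := by
        gcongr with c
        have := sum_abs_sub_add_single_le f i c.val
        rw [ZMod.natCast_zmod_val] at this
        exact this.trans (by gcongr; exact (ZMod.val_lt c).le)
    _ = _ := by simp [ZMod.card]; field_simp

lemma abs_coordDeviation_le_one {f : (Fin n → ZMod m) → ℝ} (hf : ∀ x, f x = 0 ∨ f x = 1)
    (i : Fin n) (x : Fin n → ZMod m) : |coordDeviation i f x| ≤ 1 := by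
  have hm : (0 : ℝ) < m := by exact_mod_cast Nat.pos_of_neZero m
  rw [coordDeviation_apply, abs_div, abs_of_pos hm, div_le_one hm]
  calc _ ≤ ∑ c, |f x - f (x + Pi.single i c)| := abs_sum_le_sum_abs _ _
    _ ≤ ∑ _c : ZMod m, 1 := sum_le_sum fun c _ => by
        rcases hf x with h | h <;> rcases hf (x + Pi.single i c) with h' | h' <;> simp [h, h']
    _ = m := by simp [ZMod.card]

/-- A level-type inequality: noise turns a small `L¹` norm into a small `L²` norm. -/
lemma mul_sum_torusOp_sq_sq_le (hm : 2 ≤ m) (h : (Fin n → ZMod m) → ℝ) (hh : ∀ x, |h x| ≤ 1) :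
    (m : ℝ) ^ n * (∑ x, torusOp (fun _ => 1) (fun _ => 1 / (m : ℝ)) h x ^ 2) ^ 2 ≤
      (∑ x, |h x|) ^ 3 := by
  set T := torusOp (m := m) (n := n) (fun _ => 1) (fun _ => 1 / (m : ℝ)) with hT
  set u := T (T h) with hu
  set N := ∑ x, T h x ^ 2 with hN
  set Q := ∑ x, |h x| with hQ
  have hQ0 : 0 ≤ Q := sum_nonneg fun _ _ => abs_nonneg _
  have hN0 : 0 ≤ N := sum_nonneg fun _ _ => sq_nonneg _
  have hNu : N = ∑ x, h x * u x := by simp only [hN, hu, hT, sq, sum_mul_torusOp]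
  have h4 : (m : ℝ) ^ n * ∑ x, u x ^ 4 ≤ N ^ 2 := sum_torusOp_pow_four_le hm n (T h)
  have h1 : N ^ 2 ≤ Q * ∑ x, |h x| * u x ^ 2 := by
    rw [hNu]
    refine sum_sq_le_sum_mul_sum_of_sq_le_mul _ (fun _ _ => abs_nonneg _)
      (fun _ _ => by positivity) fun x _ => ?_
    rw [← mul_assoc, abs_mul_abs_self, mul_pow, sq (h x)]
  have h2 : (∑ x, |h x| * u x ^ 2) ^ 2 ≤ Q * ∑ x, |h x| * u x ^ 4 :=
    sum_sq_le_sum_mul_sum_of_sq_le_mul _ (fun _ _ => abs_nonneg _)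
      (fun _ _ => by positivity) fun x _ => by ring_nf; rfl
  have h3 : ∑ x, |h x| * u x ^ 4 ≤ ∑ x, u x ^ 4 :=
    sum_le_sum fun x _ => mul_le_of_le_one_left (by positivity) (hh x)
  rcases hN0.eq_or_lt with h0 | h0
  · rw [← h0]; simp; positivity
  refine le_of_mul_le_mul_right ?_ (pow_pos h0 2)
  calc (m : ℝ) ^ n * N ^ 2 * N ^ 2 = (m : ℝ) ^ n * (N ^ 2) ^ 2 := by ring
    _ ≤ (m : ℝ) ^ n * (Q * ∑ x, |h x| * u x ^ 2) ^ 2 := by gcongr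
    _ = (m : ℝ) ^ n * (Q ^ 2 * (∑ x, |h x| * u x ^ 2) ^ 2) := by ring
    _ ≤ (m : ℝ) ^ n * (Q ^ 2 * (Q * ∑ x, u x ^ 4)) := by gcongr; exact h2.trans (by gcongr)
    _ = Q ^ 3 * ((m : ℝ) ^ n * ∑ x, u x ^ 4) := by ring
    _ ≤ Q ^ 3 * N ^ 2 := by gcongr

lemma prod_ite_mem_ite_eq (S : Finset (Fin n)) (i : Fin n) (r : ℝ) :
    ∏ j, (if j ∈ S then r else if j = i then 0 else 1) = if i ∈ S then r ^ #S else 0 := by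
  by_cases hi : i ∈ S
  · have : ∀ j, (if j ∈ S then r else if j = i then 0 else 1) = if j ∈ S then r else 1 := by
      intro j
      by_cases hj : j ∈ S
      · simp [hj]
      · simp [hj, show j ≠ i from fun h => hj (h ▸ hi)]
    simp only [this, hi, if_true, prod_ite_mem, univ_inter, prod_const]
  · rw [if_neg hi]
    exact prod_eq_zero (mem_univ i) (by simp [hi])

lemma sum_mul_coordDeviation (f : (Fin n → ZMod m) → ℝ) (i : Fin n) :
    ∑ x, f x * coordDeviation i f x = ∑ S, if i ∈ S then efronSteinWeight f S else 0 := by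
  rw [coordDeviation, sum_mul_torusOp_self]
  refine sum_congr rfl fun S _ => ?_
  simp only [Pi.one_apply, prod_ite_mem_ite_eq, one_pow, ite_mul, one_mul, zero_mul]

lemma sum_torusOp_coordDeviation_sq (f : (Fin n → ZMod m) → ℝ) (i : Fin n) (r : ℝ) :
    ∑ x, torusOp (fun _ => 1) (fun _ => r) (coordDeviation i f) x ^ 2 =
      ∑ S, if i ∈ S then (r ^ 2) ^ #S * efronSteinWeight f S else 0 := by
  rw [coordDeviation, torusOp_torusOp, sum_torusOp_sq, sum_mul_torusOp_self]
  refine sum_congr rfl fun S _ => ?_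
  simp only [Pi.mul_apply, mul_one, mul_ite, mul_zero]
  rw [← ite_zero_mul, ← prod_ite_mem_ite_eq]
  congr 1
  refine prod_congr rfl fun j _ => ?_
  split_ifs <;> simp [sq]

/-- The total Efron–Stein influence is at most `m` times the total influence. -/
lemma sum_card_mul_efronSteinWeight_le {f : (Fin n → ZMod m) → ℝ}
    (hf : ∀ x, f x = 0 ∨ f x = 1) :
    ∑ S, (#S : ℝ) * efronSteinWeight f S ≤ m * ∑ i, torusInfluence f i := by
  calc _ = ∑ i, ∑ x, f x * coordDeviation i f x := by
        simp only [sum_mul_coordDeviation]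
        rw [sum_comm]
        refine sum_congr rfl fun S _ => ?_
        rw [sum_ite_mem, univ_inter, sum_const, nsmul_eq_mul]
    _ ≤ ∑ i, m * torusInfluence f i := by
        refine sum_le_sum fun i _ => le_trans (sum_le_sum fun x _ => ?_)
          (sum_abs_coordDeviation_le f i)
        rcases hf x with h | h
        · simp [h]
        · simpa [h] using le_abs_self _
    _ = _ := by rw [mul_sum]

/-- The average of `f` over the coordinates outside `J`. -/
noncomputable def averageOutside (J : Finset (Fin n)) (f : (Fin n → ZMod m) → ℝ) :
    (Fin n → ZMod m) → ℝ :=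
  torusOp 1 (fun i => if i ∈ J then 1 else 0) f

lemma averageOutside_congr (J : Finset (Fin n)) (f : (Fin n → ZMod m) → ℝ)
    {x y : Fin n → ZMod m} (h : ∀ j ∈ J, x j = y j) :
    averageOutside J f x = averageOutside J f y := by
  refine sum_congr rfl fun z _ => ?_
  congr 1
  refine prod_congr rfl fun j _ => ?_
  by_cases hj : j ∈ J
  · rw [h j hj]
  · simp [meanKernel, hj]

lemma sum_sub_averageOutside_sq (J : Finset (Fin n)) (f : (Fin n → ZMod m) → ℝ) :
    ∑ x, (f x - averageOutside J f x) ^ 2 =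
      ∑ S, if S ⊆ J then 0 else efronSteinWeight f S := by
  have h1 : ∑ x, averageOutside J f x ^ 2 = ∑ x, f x * averageOutside J f x := by
    rw [averageOutside, sum_torusOp_sq]
    have : (fun i => if i ∈ J then (1 : ℝ) else 0) * (fun i => if i ∈ J then (1 : ℝ) else 0) =
        fun i => if i ∈ J then 1 else 0 := by ext i; simp
    rw [this, one_mul]
  have h2 : ∑ x, f x * f x = ∑ S, efronSteinWeight f S := by
    have := sum_mul_torusOp_self 1 1 f
    rw [torusOp_one_one] at this
    simpa using this
  have h3 : ∑ x, f x * averageOutside J f x =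
      ∑ S, if S ⊆ J then efronSteinWeight f S else 0 := by
    rw [averageOutside, sum_mul_torusOp_self]
    refine sum_congr rfl fun S _ => ?_
    by_cases hS : S ⊆ J
    · rw [if_pos hS, prod_eq_one fun j _ => ?_, one_mul]
      by_cases hj : j ∈ S
      · simp [hS hj]
      · simp [hj]
    · obtain ⟨j, hj, hj'⟩ := not_subset.1 hS
      rw [if_neg hS, prod_eq_zero (mem_univ j) (by simp [hj, hj']), zero_mul]
  calc _ = ∑ x, f x * f x - 2 * ∑ x, f x * averageOutside J f x +
        ∑ x, averageOutside J f x ^ 2 := by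
        rw [mul_sum, ← sum_sub_distrib, ← sum_add_distrib]
        exact sum_congr rfl fun x _ => by ring
    _ = ∑ x, f x * f x - ∑ x, f x * averageOutside J f x := by rw [h1]; ring
    _ = _ := by
        rw [h2, h3, ← sum_sub_distrib]
        exact sum_congr rfl fun S _ => by split_ifs <;> ring

lemma sum_sub_averageOutside_sq_le_influence (J : Finset (Fin n)) {f : (Fin n → ZMod m) → ℝ}
    (hf : ∀ x, f x = 0 ∨ f x = 1) :
    ∑ x, (f x - averageOutside J f x) ^ 2 ≤ m * ∑ i, torusInfluence f i := by
  refine le_trans ?_ (sum_card_mul_efronSteinWeight_le hf)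
  rw [sum_sub_averageOutside_sq]
  refine sum_le_sum fun S _ => ?_
  have hw := efronSteinWeight_nonneg f S
  split_ifs with hS
  · positivity
  · have : 1 ≤ #S := card_pos.2 (nonempty_iff_ne_empty.2 fun h => hS (by simp [h]))
    exact le_mul_of_one_le_left hw (by exact_mod_cast this)

/-- Splitting the Efron–Stein decomposition at level `d`. -/
lemma sum_sub_averageOutside_sq_le (J : Finset (Fin n)) {f : (Fin n → ZMod m) → ℝ}
    (hf : ∀ x, f x = 0 ∨ f x = 1) {d : ℕ} (hd : 0 < d) :
    ∑ x, (f x - averageOutside J f x) ^ 2 ≤ m * (∑ i, torusInfluence f i) / d +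
      (m : ℝ) ^ (2 * d) * ∑ i ∈ Jᶜ,
        ∑ x, torusOp (fun _ => 1) (fun _ => 1 / (m : ℝ)) (coordDeviation i f) x ^ 2 := by
  have hm : (1 : ℝ) ≤ m := by exact_mod_cast Nat.pos_of_neZero m
  have hm0 : (0 : ℝ) < m := by linarith
  have hd0 : (0 : ℝ) < d := by exact_mod_cast hd
  have hpt : ∀ S ∈ (univ : Finset (Finset (Fin n))), (if S ⊆ J then 0 else efronSteinWeight f S) ≤
      (#S : ℝ) * efronSteinWeight f S / d + (m : ℝ) ^ (2 * d) *
        ∑ i ∈ Jᶜ, if i ∈ S then ((1 / (m : ℝ)) ^ 2) ^ #S * efronSteinWeight f S else 0 := by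
    intro S _
    have hw := efronSteinWeight_nonneg f S
    have hnn : ∀ i ∈ Jᶜ, 0 ≤ if i ∈ S then ((1 / (m : ℝ)) ^ 2) ^ #S * efronSteinWeight f S else 0 :=
      fun i _ => by split_ifs <;> positivity
    have hA : 0 ≤ (#S : ℝ) * efronSteinWeight f S / d := by positivity
    have hB := mul_nonneg (pow_nonneg hm0.le (2 * d)) (sum_nonneg hnn)
    split_ifs with hS
    · exact add_nonneg hA hB
    rcases le_total d #S with hdS | hdS
    · have : efronSteinWeight f S ≤ (#S : ℝ) * efronSteinWeight f S / d := by
        rw [le_div_iff₀ hd0, mul_comm]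
        gcongr
      linarith
    · obtain ⟨j, hj, hj'⟩ := not_subset.1 hS
      have h1 := single_le_sum hnn (mem_compl.2 hj')
      rw [if_pos hj] at h1
      have h2 : efronSteinWeight f S ≤
          (m : ℝ) ^ (2 * d) * (((1 / (m : ℝ)) ^ 2) ^ #S * efronSteinWeight f S) := by
        rw [← mul_assoc]
        refine le_mul_of_one_le_left hw ?_
        rw [← pow_mul, one_div, inv_pow, ← div_eq_mul_inv, one_le_div (by positivity)]
        exact pow_le_pow_right₀ hm (by omega)
      have h3 := mul_le_mul_of_nonneg_left h1 (pow_nonneg hm0.le (2 * d))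
      linarith
  rw [sum_sub_averageOutside_sq]
  refine (sum_le_sum hpt).trans ?_
  simp only [sum_torusOp_coordDeviation_sq]
  rw [sum_add_distrib, ← sum_div, ← mul_sum, sum_comm (t := Jᶜ)]
  gcongr
  exact sum_card_mul_efronSteinWeight_le hf

lemma sum_torusOp_coordDeviation_sq_le (hm : 2 ≤ m) {f : (Fin n → ZMod m) → ℝ}
    (hf : ∀ x, f x = 0 ∨ f x = 1) {i : Fin n} {θ : ℝ} (hθ : 0 ≤ θ)
    (hi : m * torusInfluence f i ≤ θ ^ 2 * (m : ℝ) ^ n) :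
    ∑ x, torusOp (fun _ => 1) (fun _ => 1 / (m : ℝ)) (coordDeviation i f) x ^ 2 ≤
      θ * (m * torusInfluence f i) := by
  have hQ := sum_abs_coordDeviation_le f i
  have hQ0 : 0 ≤ ∑ x, |coordDeviation i f x| := sum_nonneg fun _ _ => abs_nonneg _
  have hM : (0 : ℝ) < (m : ℝ) ^ n := by positivity
  have h := mul_sum_torusOp_sq_sq_le hm (coordDeviation i f) (abs_coordDeviation_le_one hf i)
  refine le_trans ?_ (mul_le_mul_of_nonneg_left hQ hθ)
  refine le_of_sq_le_sq ?_ (by positivity)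
  refine le_of_mul_le_mul_left (h.trans ?_) hM
  calc _ = (∑ x, |coordDeviation i f x|) ^ 2 * ∑ x, |coordDeviation i f x| := by ring
    _ ≤ (∑ x, |coordDeviation i f x|) ^ 2 * (θ ^ 2 * (m : ℝ) ^ n) := by
        gcongr; exact hQ.trans hi
    _ = _ := by ring

/-- Rounding an `L²` approximation of a Boolean function. -/
lemma exists_dependsOnAtMost_of_sum_sq_le {f : (Fin n → ZMod m) → ℝ}
    (hf : ∀ x, f x = 0 ∨ f x = 1) (J : Finset (Fin n)) {k ε : ℝ} (hJ : (#J : ℝ) ≤ k)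
    (h : ∑ x, (f x - averageOutside J f x) ^ 2 ≤ ε / 4 * (m : ℝ) ^ n) :
    ∃ g : (Fin n → ZMod m) → ℝ, DependsOnAtMost n g k ∧
      ((m : ℝ) ^ n)⁻¹ * ∑ x, |f x - g x| ≤ ε := by
  have hm : (0 : ℝ) < m := by exact_mod_cast Nat.pos_of_neZero m
  refine ⟨fun x => if 1 / 2 ≤ averageOutside J f x then 1 else 0, ⟨J, hJ, fun x y hxy => ?_⟩, ?_⟩
  · simp only [averageOutside_congr J f hxy]
  · rw [inv_mul_le_iff₀ (by positivity)]
    calc _ ≤ ∑ x, 4 * (f x - averageOutside J f x) ^ 2 := by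
          gcongr with x
          beta_reduce
          rcases hf x with hx | hx <;> rw [hx] <;> split_ifs with hg <;> norm_num <;>
            first | positivity | nlinarith
      _ ≤ _ := by rw [← mul_sum]; linarith

end TorusOp

lemma junta_size_le_exp {m d : ℕ} (hm : 2 ≤ m) {I ε : ℝ} (hε : 0 < ε) (hε1 : ε < 1)
    (hI : ε < 4 * (m * I)) (hd : d ≤ 8 * (m * I) / ε + 1) :
    m * I / (ε / (8 * (m : ℝ) ^ (2 * d) * (m * I))) ^ 2 ≤
      Real.exp (100 * I * (m : ℝ) ^ 2 * Real.log ((m : ℝ) ^ 2 / ε) / ε) := by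
  have hm2 : (2 : ℝ) ≤ m := by exact_mod_cast hm
  have hm0 : (0 : ℝ) < m := by linarith
  obtain ⟨y, hy⟩ : ∃ y, y = m * I / ε := ⟨_, rfl⟩
  have hyI : m * I = y * ε := by rw [hy]; field_simp
  have hy4 : 1 / 4 < y := by rw [hy, lt_div_iff₀ hε]; linarith
  set L := Real.log ((m : ℝ) ^ 2 / ε) with hL
  have hLm : 2 * Real.log m ≤ L := by
    rw [hL, ← Real.log_rpow hm0]
    refine Real.log_le_log (by positivity) ?_
    rw [Real.rpow_ofNat, le_div_iff₀ hε]
    nlinarith [sq_nonneg (m : ℝ)]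
  have hlog2 : Real.log 2 ≤ Real.log m := Real.log_le_log (by norm_num) hm2
  have hL1 : 1 ≤ L := by linarith [Real.log_two_gt_d9]
  have hd' : (d : ℝ) ≤ 12 * y := by
    have : 8 * (m * I) / ε = 8 * y := by rw [hy]; ring
    linarith
  have hpow : (m : ℝ) ^ (4 * d) ≤ Real.exp (24 * (y * L)) := by
    rw [← Real.exp_log (pow_pos hm0 (4 * d)), Real.log_pow]
    refine Real.exp_le_exp.2 ?_
    push_cast
    have : (d : ℝ) * Real.log m ≤ 12 * y * (L / 2) :=
      mul_le_mul hd' (by linarith) (Real.log_nonneg (by linarith)) (by linarith)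
    linarith
  have hcube : (4 * y) ^ 3 ≤ Real.exp (12 * y) := by
    have h := Real.add_one_le_exp (4 * y)
    calc (4 * y) ^ 3 ≤ Real.exp (4 * y) ^ 3 := by gcongr; linarith
      _ = Real.exp (12 * y) := by rw [← Real.exp_nat_mul]; congr 1; push_cast; ring
  calc _ = ε * ((4 * y) ^ 3 * (m : ℝ) ^ (4 * d)) := by
        rw [hyI]; field_simp; ring
    _ ≤ 1 * (Real.exp (12 * y) * Real.exp (24 * (y * L))) := by gcongr
    _ = Real.exp (12 * y + 24 * (y * L)) := by rw [one_mul, Real.exp_add]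
    _ ≤ _ := by
        refine Real.exp_le_exp.2 ?_
        have h1 : 100 * I * (m : ℝ) ^ 2 * L / ε = 100 * m * (y * L) := by rw [hy]; ring
        rw [h1]
        have h2 : y ≤ y * L := le_mul_of_one_le_right (by linarith) hL1
        nlinarith [mul_nonneg (sub_nonneg.2 hm2) (by linarith : 0 ≤ y * L)]

/-- junta theorem on the discrete torus: there is a universal `C > 0` such
that for every `m ≥ 2`, `n ≥ 1`, every `f : (ℤ/mℤ)ⁿ → {0,1}` and every `ε ∈ (0,1)`, with
total influence `𝕀 = m^{-n} ∑ᵢ ∑ₓ |f(x + eᵢ) - f(x)|`, there is a function `g` depending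
on at most `exp(C 𝕀 m² log(m²/ε) / ε)` coordinates with `‖f - g‖₁ ≤ ε`. -/
theorem stmt12 :
    ∃ C : ℝ, 0 < C ∧
      ∀ (m : ℕ) [NeZero m], 2 ≤ m → ∀ (n : ℕ), 1 ≤ n →
        ∀ f : (Fin n → ZMod m) → ℝ, (∀ x, f x = 0 ∨ f x = 1) →
        ∀ ε ∈ Set.Ioo (0 : ℝ) 1,
          ∃ g : (Fin n → ZMod m) → ℝ,
            DependsOnAtMost n g
              (Real.exp (C * (((m : ℝ) ^ n)⁻¹ *
                  ∑ i : Fin n, ∑ x : Fin n → ZMod m, |f (x + Pi.single i 1) - f x|) *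
                (m : ℝ) ^ 2 * Real.log ((m : ℝ) ^ 2 / ε) / ε)) ∧
            ((m : ℝ) ^ n)⁻¹ * ∑ x : Fin n → ZMod m, |f x - g x| ≤ ε := by
  refine ⟨100, by norm_num, fun m _ hm n _ f hf ε ⟨hε, hε1⟩ => ?_⟩
  have hm0 : (0 : ℝ) < m := by positivity
  have hM : (0 : ℝ) < (m : ℝ) ^ n := by positivity
  change ∃ g : (Fin n → ZMod m) → ℝ, DependsOnAtMost n g
    (Real.exp (100 * (((m : ℝ) ^ n)⁻¹ * ∑ i, torusInfluence f i) *
      (m : ℝ) ^ 2 * Real.log ((m : ℝ) ^ 2 / ε) / ε)) ∧ _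
  generalize hI : ((m : ℝ) ^ n)⁻¹ * ∑ i, torusInfluence f i = I
  have hIM : ∑ i, torusInfluence f i = I * (m : ℝ) ^ n := by rw [← hI]; field_simp
  rcases le_or_gt (4 * (m * I)) ε with hsmall | hlarge
  · refine exists_dependsOnAtMost_of_sum_sq_le hf ∅ (by simpa using (Real.exp_pos _).le) ?_
    refine (sum_sub_averageOutside_sq_le_influence ∅ hf).trans ?_
    rw [hIM, ← mul_assoc]
    gcongr
    linarith
  have hmI : 0 < m * I := by linarith
  obtain ⟨d, hd⟩ : ∃ d, d = ⌈8 * (m * I) / ε⌉₊ := ⟨_, rfl⟩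
  have hd0 : 0 < d := by rw [hd, Nat.ceil_pos]; positivity
  have hd1 : 8 * (m * I) / ε ≤ d := by rw [hd]; exact Nat.le_ceil _
  have hd2 : (d : ℝ) ≤ 8 * (m * I) / ε + 1 := by
    rw [hd]; exact (Nat.ceil_lt_add_one (by positivity)).le
  obtain ⟨θ, hθ⟩ : ∃ θ, θ = ε / (8 * (m : ℝ) ^ (2 * d) * (m * I)) := ⟨_, rfl⟩
  have hθ0 : 0 < θ := by rw [hθ]; positivity
  refine exists_dependsOnAtMost_of_sum_sq_le hf
    ({i | θ ^ 2 * (m : ℝ) ^ n < m * torusInfluence f i} : Finset (Fin n))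
    (le_trans ?_ (junta_size_le_exp hm hε hε1 hlarge hd2)) ?_
  · rw [← hθ, le_div_iff₀ (by positivity)]
    refine le_of_mul_le_mul_right ?_ hM
    calc _ = ∑ i ∈ ({i | θ ^ 2 * (m : ℝ) ^ n < m * torusInfluence f i} : Finset (Fin n)),
          θ ^ 2 * (m : ℝ) ^ n := by rw [sum_const, nsmul_eq_mul]; ring
      _ ≤ ∑ i ∈ ({i | θ ^ 2 * (m : ℝ) ^ n < m * torusInfluence f i} : Finset (Fin n)),
          m * torusInfluence f i := sum_le_sum fun i hi => (mem_filter.1 hi).2.le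
      _ ≤ ∑ i, m * torusInfluence f i :=
          sum_le_univ_sum_of_nonneg fun i => mul_nonneg hm0.le (torusInfluence_nonneg f i)
      _ = _ := by rw [← mul_sum, hIM, mul_assoc]
  · refine (sum_sub_averageOutside_sq_le _ hf hd0).trans ?_
    have hlow : ∑ i ∈ ({i | θ ^ 2 * (m : ℝ) ^ n < m * torusInfluence f i} : Finset (Fin n))ᶜ,
        ∑ x, torusOp (fun _ => 1) (fun _ => 1 / (m : ℝ)) (coordDeviation i f) x ^ 2 ≤
        θ * (m * I * (m : ℝ) ^ n) := by
      calc _ ≤ ∑ i ∈ ({i | θ ^ 2 * (m : ℝ) ^ n < m * torusInfluence f i} : Finset (Fin n))ᶜ,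
            θ * (m * torusInfluence f i) := sum_le_sum fun i hi =>
              sum_torusOp_coordDeviation_sq_le hm hf hθ0.le (by simpa using hi)
        _ ≤ ∑ i, θ * (m * torusInfluence f i) := sum_le_univ_sum_of_nonneg fun i =>
              mul_nonneg hθ0.le (mul_nonneg hm0.le (torusInfluence_nonneg f i))
        _ = _ := by rw [← mul_sum, ← mul_sum, hIM]; ring
    have hhigh : m * I / d ≤ ε / 8 := by
      rw [div_le_iff₀ (by exact_mod_cast hd0)]
      rw [div_le_iff₀ hε] at hd1
      linarith
    have hθ' : (m : ℝ) ^ (2 * d) * (θ * (m * I)) = ε / 8 := by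
      have hI0 : I ≠ 0 := right_ne_zero_of_mul hmI.ne'
      rw [hθ]; field_simp
    calc _ ≤ m * (I * (m : ℝ) ^ n) / d + (m : ℝ) ^ (2 * d) * (θ * (m * I * (m : ℝ) ^ n)) := by
          rw [hIM]; gcongr
      _ = (m * I / d + (m : ℝ) ^ (2 * d) * (θ * (m * I))) * (m : ℝ) ^ n := by ring
      _ ≤ (ε / 8 + ε / 8) * (m : ℝ) ^ n := by rw [hθ']; gcongr
      _ = _ := by ring
end
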